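/- arXiv:2404.03281 — 3 statements merged into one kernel-verified Lean document; each statement's English description precedes it below -/
import Mathlib

section
/- Let k be a field of characteristic 3 and t ∈ k with t ∉ k³. Let b, f ∈ k[X] be polynomials of degree at most 2 such that the ideal m of k[X,Y] generated by X³ − t and bY − f is maximal. Then either m contains a nonzero polynomial of total degree at most 1, or the k-vector space V = {F ∈ m : total degree of F is at most 2} has dimension at least 3 over k and every nonzero element of V is irreducible in k̄[X,Y], where k̄ is an algebraic closure of k. (Equivalently: either the degree-3 purely inseparable point lies on a line defined over k, or there is a web of geometrically integral conics through it.) -/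
open MvPolynomial in
/-- A polynomial in two variables of total degree at most `1` is an affine form. -/
theorem MvPolynomial.exists_eq_of_totalDegree_le_one {R : Type*} [CommRing R]
    (p : MvPolynomial (Fin 2) R) (hp : p.totalDegree ≤ 1) :
    ∃ a b c : R, p = C a + C b * X 0 + C c * X 1 := by
  have key : ∀ s ∈ p.support, ∃ a b c : R,
      monomial s (coeff s p) = C a + C b * X 0 + C c * X 1 := by
    intro s hs
    have h1 := (le_totalDegree hs).trans hp
    rw [Finsupp.sum_fintype _ _ (fun _ => rfl), Fin.sum_univ_two] at h1
    rw [monomial_eq, Finsupp.prod_fintype _ _ (fun _ => pow_zero _), Fin.prod_univ_two]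
    generalize s 0 = m at *
    generalize s 1 = n at *
    have hm : m ≤ 1 := by omega
    have hn : n ≤ 1 := by omega
    interval_cases m <;> interval_cases n
    · exact ⟨coeff s p, 0, 0, by simp⟩
    · exact ⟨0, 0, coeff s p, by simp⟩
    · exact ⟨0, coeff s p, 0, by simp⟩
    · omega
  rw [p.as_sum]
  refine Finset.sum_induction _ (fun q => ∃ a b c : R, q = C a + C b * X 0 + C c * X 1)
    ?_ ⟨0, 0, 0, by simp⟩ key
  rintro _ _ ⟨a, b, c, rfl⟩ ⟨a', b', c', rfl⟩
  exact ⟨a + a', b + b', c + c', by simp only [map_add]; ring⟩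

open MvPolynomial in
/-- A polynomial in two variables of total degree at most `2` is a combination of the six monomials
of degree at most `2`. -/
theorem MvPolynomial.exists_eq_of_totalDegree_le_two {R : Type*} [CommRing R]
    (p : MvPolynomial (Fin 2) R) (hp : p.totalDegree ≤ 2) :
    ∃ a b c d e g : R, p = C a + C b * X 0 ^ 2 + C c * X 1 ^ 2 + C d * (X 0 * X 1) +
      C e * X 1 + C g * X 0 := by
  have key : ∀ s ∈ p.support, ∃ a b c d e g : R,
      monomial s (coeff s p) = C a + C b * X 0 ^ 2 + C c * X 1 ^ 2 + C d * (X 0 * X 1) +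
        C e * X 1 + C g * X 0 := by
    intro s hs
    have h1 := (le_totalDegree hs).trans hp
    rw [Finsupp.sum_fintype _ _ (fun _ => rfl), Fin.sum_univ_two] at h1
    rw [monomial_eq, Finsupp.prod_fintype _ _ (fun _ => pow_zero _), Fin.prod_univ_two]
    generalize s 0 = m at *
    generalize s 1 = n at *
    have hm : m ≤ 2 := by omega
    have hn : n ≤ 2 := by omega
    interval_cases m <;> interval_cases n
    · exact ⟨coeff s p, 0, 0, 0, 0, 0, by simp⟩
    · exact ⟨0, 0, 0, 0, coeff s p, 0, by simp⟩
    · exact ⟨0, 0, coeff s p, 0, 0, 0, by simp⟩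
    · exact ⟨0, 0, 0, 0, 0, coeff s p, by simp⟩
    · exact ⟨0, 0, 0, coeff s p, 0, 0, by simp⟩
    · omega
    · exact ⟨0, coeff s p, 0, 0, 0, 0, by simp⟩
    · omega
    · omega
  rw [p.as_sum]
  refine Finset.sum_induction _ (fun q => ∃ a b c d e g : R, q = C a + C b * X 0 ^ 2 +
    C c * X 1 ^ 2 + C d * (X 0 * X 1) + C e * X 1 + C g * X 0)
    ?_ ⟨0, 0, 0, 0, 0, 0, by simp⟩ key
  rintro _ _ ⟨a, b, c, d, e, g, rfl⟩ ⟨a', b', c', d', e', g', rfl⟩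
  exact ⟨a + a', b + b', c + c', d + d', e + e', g + g', by simp only [map_add]; ring⟩

/-- In characteristic `3`, an element outside `k` whose cube lies in `k` satisfies no nontrivial
quadratic equation over `k`. -/
theorem quadratic_coeffs_eq_zero_of_cube_mem {k L : Type*} [Field k] [CharP k 3] [Field L]
    [Algebra k L] {r : L} {ρ : k} (hr : r ^ 3 = algebraMap k L ρ)
    (hk : ∀ a : k, algebraMap k L a ≠ r) {α β γ : k}
    (h : algebraMap k L α + algebraMap k L β * r + algebraMap k L γ * r ^ 2 = 0) :
    α = 0 ∧ β = 0 ∧ γ = 0 := by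
  have inj := FaithfulSMul.algebraMap_injective k L
  have linear : ∀ p q : k, algebraMap k L p + algebraMap k L q * r = 0 → p = 0 ∧ q = 0 := by
    intro p q hpq
    have hq : q = 0 := by
      by_contra hq
      have hq' : algebraMap k L q ≠ 0 := fun h0 => hq (inj (by simpa using h0))
      refine hk (-p / q) ?_
      rw [map_div₀, map_neg, div_eq_iff hq']
      linear_combination -hpq
    subst hq
    exact ⟨inj (by simpa using hpq), rfl⟩
  have hγ : γ = 0 := by
    by_contra hγ
    have h3 : (3 : L) = 0 := by
      have : (3 : k) = 0 := by exact_mod_cast CharP.cast_eq_zero k 3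
      rw [← map_ofNat (algebraMap k L) 3, this, map_zero]
    have hγ' : algebraMap k L γ ≠ 0 := fun h0 => hγ (inj (by simpa using h0))
    obtain ⟨-, hsq⟩ := linear (γ ^ 2 * ρ - α * β) (α * γ - β ^ 2) (by
      simp only [map_sub, map_mul, map_pow]
      rw [← hr]
      linear_combination (algebraMap k L γ * r - algebraMap k L β) * h)
    have hsq' := congrArg (algebraMap k L) hsq
    simp only [map_sub, map_mul, map_pow, map_zero] at hsq'
    have hroot : (algebraMap k L γ * r - algebraMap k L β) ^ 2 = 0 := by
      linear_combination algebraMap k L γ * h - algebraMap k L β * algebraMap k L γ * r * h3 - hsq'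
    refine hk (β / γ) ?_
    rw [map_div₀, div_eq_iff hγ']
    linear_combination -(pow_eq_zero_iff two_ne_zero).1 hroot
  subst hγ
  obtain ⟨h0, h1⟩ := linear α β (by simpa using h)
  exact ⟨h0, h1, rfl⟩

/-- Let every element of `L` have its cube in `k`, and let `w` be a zero in `L³` of a ternary
quadratic form over `k` whose Gram matrix annihilates a vector with nonzero first coordinate. If
the coordinates of `w` are linearly independent over `k`, then the form is zero. -/
theorem ternary_form_eq_zero_of_kernel {k L : Type*} [Field k] [CharP k 3] [Field L]
    [Algebra k L] (hL : ∀ z : L, ∃ ρ : k, z ^ 3 = algebraMap k L ρ) {w₀ w₁ w₂ : L}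
    (hw : ∀ a b c : k, algebraMap k L a * w₀ + algebraMap k L b * w₁ + algebraMap k L c * w₂ = 0 →
      a = 0 ∧ b = 0 ∧ c = 0)
    {A B C D E G v₀ v₁ v₂ : k} (hv : v₀ ≠ 0)
    (h₀ : 2 * A * v₀ + G * v₁ + E * v₂ = 0) (h₁ : G * v₀ + 2 * B * v₁ + D * v₂ = 0)
    (h₂ : E * v₀ + D * v₁ + 2 * C * v₂ = 0)
    (hQ : algebraMap k L A * w₀ ^ 2 + algebraMap k L B * w₁ ^ 2 + algebraMap k L C * w₂ ^ 2 +
      algebraMap k L D * (w₁ * w₂) + algebraMap k L E * (w₀ * w₂) +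
      algebraMap k L G * (w₀ * w₁) = 0) :
    A = 0 ∧ B = 0 ∧ C = 0 ∧ D = 0 ∧ E = 0 ∧ G = 0 := by
  have h3 : (3 : k) = 0 := by exact_mod_cast CharP.cast_eq_zero k 3
  have h2 : (2 : k) ≠ 0 := fun h => one_ne_zero (by linear_combination h3 - h)
  have h2' : (2 : L) ≠ 0 := by
    rw [← map_ofNat (algebraMap k L) 2]
    exact (map_ne_zero _).2 h2
  set φ := algebraMap k L with hφ
  set u₁ := φ v₀ * w₁ - φ v₁ * w₀ with hu₁
  set u₂ := φ v₀ * w₂ - φ v₂ * w₀ with hu₂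
  have hu₁0 : u₁ ≠ 0 := by
    intro h
    exact hv (hw (-v₁) v₀ 0 (by rw [map_neg, map_zero]; linear_combination h)).2.1
  have hr : ∀ a : k, φ a ≠ u₂ / u₁ := by
    intro a ha
    rw [eq_div_iff hu₁0] at ha
    exact hv (hw (a * v₁ - v₂) (-a * v₀) v₀
      (by simp only [map_sub, map_mul, map_neg]; linear_combination -ha)).2.2
  have h₀' := congrArg φ h₀
  have h₁' := congrArg φ h₁
  have h₂' := congrArg φ h₂
  simp only [map_add, map_mul, map_zero, map_ofNat] at h₀' h₁' h₂'
  have hbin : φ B * u₁ ^ 2 + φ D * (u₁ * u₂) + φ C * u₂ ^ 2 = 0 := by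
    refine (mul_eq_zero.1 ?_).resolve_left h2'
    linear_combination 2 * φ v₀ ^ 2 * hQ - φ v₀ * w₀ ^ 2 * h₀'
      + (φ v₁ * w₀ - 2 * φ v₀ * w₁) * w₀ * h₁' + (φ v₂ * w₀ - 2 * φ v₀ * w₂) * w₀ * h₂'
  obtain ⟨ρ, hρ⟩ := hL (u₂ / u₁)
  obtain ⟨rfl, rfl, rfl⟩ := quadratic_coeffs_eq_zero_of_cube_mem (α := B) (β := D) (γ := C) hρ hr
    (by rw [← hφ]; field_simp; linear_combination hbin)
  have hG : G = 0 := (mul_eq_zero.1 (by linear_combination h₁)).resolve_right hv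
  have hE : E = 0 := (mul_eq_zero.1 (by linear_combination h₂)).resolve_right hv
  subst hG hE
  have hA : 2 * A = 0 := (mul_eq_zero.1 (by linear_combination h₀)).resolve_right hv
  exact ⟨(mul_eq_zero.1 hA).resolve_left h2, rfl, rfl, rfl, rfl, rfl⟩

/-- Let every element of `L` have its cube in `k`. A degenerate ternary quadratic form over `k`
with a zero in `L³` whose coordinates are linearly independent over `k` is zero. -/
theorem ternary_form_eq_zero_of_det_eq_zero {k L : Type*} [Field k] [CharP k 3] [Field L]
    [Algebra k L] (hL : ∀ z : L, ∃ ρ : k, z ^ 3 = algebraMap k L ρ) {w₀ w₁ w₂ : L}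
    (hw : ∀ a b c : k, algebraMap k L a * w₀ + algebraMap k L b * w₁ + algebraMap k L c * w₂ = 0 →
      a = 0 ∧ b = 0 ∧ c = 0)
    {A B C D E G : k}
    (hdet : 4 * A * B * C + D * E * G - A * D ^ 2 - B * E ^ 2 - C * G ^ 2 = 0)
    (hQ : algebraMap k L A * w₀ ^ 2 + algebraMap k L B * w₁ ^ 2 + algebraMap k L C * w₂ ^ 2 +
      algebraMap k L D * (w₁ * w₂) + algebraMap k L E * (w₀ * w₂) +
      algebraMap k L G * (w₀ * w₁) = 0) :
    A = 0 ∧ B = 0 ∧ C = 0 ∧ D = 0 ∧ E = 0 ∧ G = 0 := by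
  have hM : (!![2 * A, G, E; G, 2 * B, D; E, D, 2 * C] : Matrix (Fin 3) (Fin 3) k).det = 0 := by
    rw [Matrix.det_fin_three]
    simp
    linear_combination 2 * hdet
  obtain ⟨v, hv, hMv⟩ := Matrix.exists_mulVec_eq_zero_iff.2 hM
  have h₀ := congrFun hMv 0
  have h₁ := congrFun hMv 1
  have h₂ := congrFun hMv 2
  simp [Matrix.mulVec, dotProduct, Fin.sum_univ_three] at h₀ h₁ h₂
  obtain ⟨i, hi⟩ := Function.ne_iff.1 hv
  fin_cases i
  · exact ternary_form_eq_zero_of_kernel hL hw hi h₀ h₁ h₂ hQ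
  · obtain ⟨hB, hA, hC, hE, hD, hG⟩ := ternary_form_eq_zero_of_kernel hL (w₀ := w₁) (w₁ := w₀)
      (w₂ := w₂) (A := B) (B := A) (C := C) (D := E) (E := D) (G := G)
      (v₀ := v 1) (v₁ := v 0) (v₂ := v 2)
      (fun a b c h => by
        obtain ⟨h1, h2, h3⟩ := hw b a c (by linear_combination h)
        exact ⟨h2, h1, h3⟩)
      hi (by linear_combination h₁) (by linear_combination h₀) (by linear_combination h₂)
      (by linear_combination hQ)
    exact ⟨hA, hB, hC, hD, hE, hG⟩
  · obtain ⟨hC, hB, hA, hG, hE, hD⟩ := ternary_form_eq_zero_of_kernel hL (w₀ := w₂) (w₁ := w₁)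
      (w₂ := w₀) (A := C) (B := B) (C := A) (D := G) (E := E) (G := D)
      (v₀ := v 2) (v₁ := v 1) (v₂ := v 0)
      (fun a b c h => by
        obtain ⟨h1, h2, h3⟩ := hw c b a (by linear_combination h)
        exact ⟨h3, h2, h1⟩)
      hi (by linear_combination h₂) (by linear_combination h₁) (by linear_combination h₀)
      (by linear_combination hQ)
    exact ⟨hA, hB, hC, hD, hE, hG⟩

open MvPolynomial in
/-- Over a field of characteristic other than `2`, the six monomials of degree at most `2` in two
variables are linearly independent. -/
theorem MvPolynomial.conic_coeffs_eq_zero {K : Type*} [Field K] (h2 : (2 : K) ≠ 0)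
    {a b c d e g : K} (h : (C a + C b * X 0 ^ 2 + C c * X 1 ^ 2 + C d * (X 0 * X 1) +
      C e * X 1 + C g * X 0 : MvPolynomial (Fin 2) K) = 0) :
    a = 0 ∧ b = 0 ∧ c = 0 ∧ d = 0 ∧ e = 0 ∧ g = 0 := by
  have ev : ∀ x y : K, a + b * x ^ 2 + c * y ^ 2 + d * (x * y) + e * y + g * x = 0 := by
    intro x y
    simpa using congrArg (eval ![x, y]) h
  have h1 := ev 0 0
  have h3 := ev 1 0
  have h4 := ev (-1) 0
  have h5 := ev 0 1
  have h6 := ev 0 (-1)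
  have h7 := ev 1 1
  have ha : a = 0 := by linear_combination h1
  have hb : b = 0 := (mul_eq_zero.1 (by linear_combination h3 + h4 - 2 * h1)).resolve_left h2
  have hc : c = 0 := (mul_eq_zero.1 (by linear_combination h5 + h6 - 2 * h1)).resolve_left h2
  have hg : g = 0 := by linear_combination h3 - hb - ha
  have he : e = 0 := by linear_combination h5 - hc - ha
  exact ⟨ha, hb, hc, by linear_combination h7 - ha - hb - hc - he - hg, he, hg⟩

open MvPolynomial in
/-- A conic with nonzero discriminant over a field of characteristic other than `2` is
irreducible. -/
theorem MvPolynomial.irreducible_conic {K : Type*} [Field K] (h2 : (2 : K) ≠ 0)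
    {a b c d e g : K} (hdet : 4 * a * b * c + d * e * g - a * d ^ 2 - b * e ^ 2 - c * g ^ 2 ≠ 0) :
    Irreducible (C a + C b * X 0 ^ 2 + C c * X 1 ^ 2 + C d * (X 0 * X 1) +
      C e * X 1 + C g * X 0 : MvPolynomial (Fin 2) K) := by
  set q : MvPolynomial (Fin 2) K := C a + C b * X 0 ^ 2 + C c * X 1 ^ 2 + C d * (X 0 * X 1) +
      C e * X 1 + C g * X 0 with hq
  have hdeg : q.totalDegree ≤ 2 := by
    have t0 (r : K) : (C r : MvPolynomial (Fin 2) K).totalDegree ≤ 0 := (totalDegree_C r).le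
    have t1 (i : Fin 2) : (X i : MvPolynomial (Fin 2) K).totalDegree ≤ 1 := (totalDegree_X i).le
    have tm {p p' : MvPolynomial (Fin 2) K} {m n l : ℕ} (hp : p.totalDegree ≤ m)
        (hp' : p'.totalDegree ≤ n) (hl : m + n ≤ l) : (p * p').totalDegree ≤ l :=
      (totalDegree_mul _ _).trans ((add_le_add hp hp').trans hl)
    have ta {p p' : MvPolynomial (Fin 2) K} (hp : p.totalDegree ≤ 2)
        (hp' : p'.totalDegree ≤ 2) : (p + p').totalDegree ≤ 2 :=
      (totalDegree_add _ _).trans (max_le hp hp')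
    have ts (i : Fin 2) : (X i ^ 2 : MvPolynomial (Fin 2) K).totalDegree ≤ 2 := by
      rw [pow_two]
      exact tm (t1 i) (t1 i) le_rfl
    refine ta (ta (ta (ta (ta ((t0 a).trans (by norm_num)) ?_) ?_) ?_) ?_) ?_
    · exact tm (t0 b) (ts 0) le_rfl
    · exact tm (t0 c) (ts 1) le_rfl
    · exact tm (t0 d) (tm (t1 0) (t1 1) le_rfl) le_rfl
    · exact tm (t0 e) (t1 1) (by norm_num)
    · exact tm (t0 g) (t1 0) (by norm_num)
  have hconst : ∀ r : K, q ≠ C r := by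
    intro r h
    obtain ⟨-, hb, hc, hd, he, hg⟩ := conic_coeffs_eq_zero h2 (a := a - r) (b := b) (c := c)
      (d := d) (e := e) (g := g) (by rw [map_sub]; linear_combination h)
    exact hdet (by rw [hb, hc, hd, he, hg]; ring)
  have hq0 : q ≠ 0 := by simpa using hconst 0
  have hpos : ∀ A : MvPolynomial (Fin 2) K, A ≠ 0 → ¬IsUnit A → 1 ≤ A.totalDegree := by
    intro A hA hA'
    by_contra hlt
    have hAC := totalDegree_eq_zero_iff_eq_C.1 (by omega : A.totalDegree = 0)
    rw [hAC] at hA hA'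
    refine hA' (IsUnit.map C (isUnit_iff_ne_zero.2 fun h0 => hA ?_))
    rw [h0, map_zero]
  refine ⟨fun hu => ?_, fun {A B} hAB => ?_⟩
  · obtain ⟨r, -, hr⟩ := isUnit_iff_eq_C_of_isReduced.1 hu
    exact hconst r hr
  · by_contra! hn
    have hA0 : A ≠ 0 := by rintro rfl; exact hq0 (by rw [hAB, zero_mul])
    have hB0 : B ≠ 0 := by rintro rfl; exact hq0 (by rw [hAB, mul_zero])
    have hA := hpos A hA0 hn.1
    have hB := hpos B hB0 hn.2
    rw [hAB, totalDegree_mul_of_isDomain hA0 hB0] at hdeg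
    obtain ⟨a₀, a₁, a₂, rfl⟩ := A.exists_eq_of_totalDegree_le_one (by omega)
    obtain ⟨b₀, b₁, b₂, rfl⟩ := B.exists_eq_of_totalDegree_le_one (by omega)
    obtain ⟨ha, hb, hc, hd, he, hg⟩ := conic_coeffs_eq_zero h2 (a := a - a₀ * b₀)
      (b := b - a₁ * b₁) (c := c - a₂ * b₂) (d := d - (a₁ * b₂ + a₂ * b₁))
      (e := e - (a₀ * b₂ + a₂ * b₀)) (g := g - (a₀ * b₁ + a₁ * b₀))
      (by simp only [map_sub, map_add, map_mul]; linear_combination hAB)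
    rw [sub_eq_zero] at ha hb hc hd he hg
    refine hdet ?_
    subst ha hb hc hd he hg
    ring

open MvPolynomial in
/-- A `k`-rational evaluation of `k[X, Y]` in an extension of degree at most `3` vanishes on three
linearly independent polynomials of total degree at most `2`. -/
theorem MvPolynomial.exists_three_conics {k L : Type*} [Field k] [Field L] [Algebra k L]
    [FiniteDimensional k L] (hkL : Module.finrank k L ≤ 3) (h2 : (2 : k) ≠ 0)
    (p : Fin 2 → L) :
    ∃ v : Fin 3 → MvPolynomial (Fin 2) k,
      (∀ i, aeval p (v i) = 0 ∧ (v i).totalDegree ≤ 2) ∧ LinearIndependent k v := by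
  let S := restrictTotalDegree (Fin 2) k 2
  let m : Fin 6 → S := ![⟨1, by simp [S, mem_restrictTotalDegree]⟩,
    ⟨X 0 ^ 2, by simp [S, mem_restrictTotalDegree]⟩,
    ⟨X 1 ^ 2, by simp [S, mem_restrictTotalDegree]⟩,
    ⟨X 0 * X 1, by
      rw [mem_restrictTotalDegree]
      exact (totalDegree_mul _ _).trans (by simp)⟩,
    ⟨X 1, by simp [S, mem_restrictTotalDegree]⟩, ⟨X 0, by simp [S, mem_restrictTotalDegree]⟩]
  have hm : LinearIndependent k m := by
    rw [Fintype.linearIndependent_iff]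
    intro c hc
    have hc' := congrArg (Subtype.val) hc
    simp only [Fin.sum_univ_six, m] at hc'
    obtain ⟨h0, h1, h2, h3, h4, h5⟩ := conic_coeffs_eq_zero h2 (a := c 0) (b := c 1) (c := c 2)
      (d := c 3) (e := c 4) (g := c 5) (by simpa [smul_eq_C_mul] using hc')
    intro i
    fin_cases i <;> assumption
  let ψ : (Fin 6 → k) →ₗ[k] S := Fintype.linearCombination k m
  have hψ : Function.Injective ψ := linearIndependent_iff_injective_fintypeLinearCombination.1 hm
  let χ : (Fin 6 → k) →ₗ[k] L := (aeval p).toLinearMap ∘ₗ S.subtype ∘ₗ ψ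
  have hker : 3 ≤ Module.finrank k (LinearMap.ker χ) := by
    have h := LinearMap.finrank_range_add_finrank_ker χ
    have h' := Submodule.finrank_le (LinearMap.range χ)
    rw [Module.finrank_fin_fun] at h
    omega
  obtain ⟨w, hw⟩ := exists_linearIndependent_of_le_finrank hker
  refine ⟨fun i => (ψ (w i : Fin 6 → k) : MvPolynomial (Fin 2) k), fun i => ⟨?_, ?_⟩, ?_⟩
  · exact (w i).2
  · exact (mem_restrictTotalDegree _ _ _).1 (ψ (w i : Fin 6 → k)).2
  · exact hw.map' (S.subtype ∘ₗ ψ ∘ₗ (LinearMap.ker χ).subtype)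
      (LinearMap.ker_eq_bot.2
        (Subtype.val_injective.comp (hψ.comp Subtype.val_injective)))

/-- In characteristic `3`, a nonzero polynomial of degree at most `2` over `k` does not vanish at a
cube root of a non-cube of `k`. -/
theorem eq_zero_of_aeval_cube_root_eq_zero {k K : Type*} [Field k] [CharP k 3] [Field K]
    [Algebra k K] {t : k} (ht : ∀ a : k, a ^ 3 ≠ t) {r : K} (hr : r ^ 3 = algebraMap k K t)
    {h : Polynomial k} (hdeg : h.natDegree ≤ 2) (h0 : Polynomial.aeval r h = 0) : h = 0 := by
  have hr' : ∀ a : k, algebraMap k K a ≠ r := by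
    rintro a rfl
    rw [← map_pow] at hr
    exact ht a (FaithfulSMul.algebraMap_injective k K hr)
  rw [Polynomial.aeval_eq_sum_range' (n := 3) (by omega)] at h0
  simp only [Finset.sum_range_succ, Finset.sum_range_zero, Algebra.smul_def] at h0
  obtain ⟨e0, e1, e2⟩ := quadratic_coeffs_eq_zero_of_cube_mem hr hr' (α := h.coeff 0)
    (β := h.coeff 1) (γ := h.coeff 2) (by linear_combination h0)
  ext n
  rw [Polynomial.coeff_zero]
  rcases Nat.lt_or_ge n 3 with hn | hn
  · interval_cases n <;> assumption
  · exact Polynomial.coeff_eq_zero_of_natDegree_lt (by omega)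

/-- Let `k` be a field of characteristic `3` and `t ∈ k \ k³`.  If `b, f ∈ k[X]` have degree at
most `2` and the ideal `m = (X³ − t, b(X)Y − f(X))` of `k[X,Y]` is maximal, then either `m`
contains a nonzero polynomial of total degree at most `1`, or the space of elements of `m` of
total degree at most `2` contains three `k`-linearly independent elements, all of whose nonzero
members are irreducible over an algebraic closure `k̄` of `k` (a web of geometrically integral
conics through the purely inseparable point of degree `3`). -/
theorem degree_three_inseparable_point_line_or_web_of_conics
    (k : Type*) [Field k] [CharP k 3]
    (t : k) (ht : ∀ a : k, a ^ 3 ≠ t) (b f : Polynomial k)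
    (hb : b.natDegree ≤ 2) (hf : f.natDegree ≤ 2)
    (hm : (Ideal.span
      {MvPolynomial.X 0 ^ 3 - MvPolynomial.C t,
       Polynomial.aeval (MvPolynomial.X 0 : MvPolynomial (Fin 2) k) b * MvPolynomial.X 1 -
         Polynomial.aeval (MvPolynomial.X 0 : MvPolynomial (Fin 2) k) f} :
      Ideal (MvPolynomial (Fin 2) k)).IsMaximal) :
    (∃ F ∈ (Ideal.span
      {MvPolynomial.X 0 ^ 3 - MvPolynomial.C t,
       Polynomial.aeval (MvPolynomial.X 0 : MvPolynomial (Fin 2) k) b * MvPolynomial.X 1 -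
         Polynomial.aeval (MvPolynomial.X 0 : MvPolynomial (Fin 2) k) f} :
      Ideal (MvPolynomial (Fin 2) k)), F ≠ 0 ∧ F.totalDegree ≤ 1) ∨
    ((∃ v : Fin 3 → MvPolynomial (Fin 2) k,
      (∀ i, v i ∈ (Ideal.span
        {MvPolynomial.X 0 ^ 3 - MvPolynomial.C t,
         Polynomial.aeval (MvPolynomial.X 0 : MvPolynomial (Fin 2) k) b * MvPolynomial.X 1 -
           Polynomial.aeval (MvPolynomial.X 0 : MvPolynomial (Fin 2) k) f} :
        Ideal (MvPolynomial (Fin 2) k)) ∧ (v i).totalDegree ≤ 2) ∧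
      LinearIndependent k v) ∧
    (∀ F ∈ (Ideal.span
      {MvPolynomial.X 0 ^ 3 - MvPolynomial.C t,
       Polynomial.aeval (MvPolynomial.X 0 : MvPolynomial (Fin 2) k) b * MvPolynomial.X 1 -
         Polynomial.aeval (MvPolynomial.X 0 : MvPolynomial (Fin 2) k) f} :
      Ideal (MvPolynomial (Fin 2) k)), F ≠ 0 → F.totalDegree ≤ 2 →
      Irreducible (MvPolynomial.map (algebraMap k (AlgebraicClosure k)) F))) := by
  have h3 : (3 : k) = 0 := by exact_mod_cast CharP.cast_eq_zero k 3
  have h2 : (2 : k) ≠ 0 := fun h => one_ne_zero (by linear_combination h3 - h)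
  have hirr : Irreducible (Polynomial.X ^ 3 - Polynomial.C t : Polynomial k) :=
    X_pow_sub_C_irreducible_of_prime Nat.prime_three ht
  have := Fact.mk hirr
  let P : Polynomial k := Polynomial.X ^ 3 - Polynomial.C t
  have hP : P.natDegree = 3 := Polynomial.natDegree_X_pow_sub_C
  let L := AdjoinRoot P
  let α : L := AdjoinRoot.root P
  have hα : α ^ 3 = algebraMap k L t := by
    have h := AdjoinRoot.aeval_eq (f := P) P
    rw [AdjoinRoot.mk_self] at h
    rw [map_sub, map_pow, Polynomial.aeval_X, Polynomial.aeval_C] at h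
    exact sub_eq_zero.1 h
  have hcube : ∀ z : L, ∃ ρ : k, z ^ 3 = algebraMap k L ρ := by
    have : CharP L 3 := charP_of_injective_algebraMap (FaithfulSMul.algebraMap_injective k L) 3
    intro z
    obtain ⟨q, rfl⟩ := AdjoinRoot.mk_surjective z
    induction q using Polynomial.induction_on' with
    | add p q hp hq =>
      obtain ⟨r, hr⟩ := hp
      obtain ⟨s, hs⟩ := hq
      exact ⟨r + s, by rw [map_add, add_pow_char, hr, hs, map_add]⟩
    | monomial n a =>
      refine ⟨a ^ 3 * t ^ n, ?_⟩
      rw [← Polynomial.C_mul_X_pow_eq_monomial, map_mul, map_pow, AdjoinRoot.mk_X, mul_pow,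
        AdjoinRoot.mk_C, map_mul, map_pow, map_pow, ← hα, ← pow_mul, ← pow_mul, mul_comm n 3]
      rfl
  set m := (Ideal.span
      {MvPolynomial.X 0 ^ 3 - MvPolynomial.C t,
       Polynomial.aeval (MvPolynomial.X 0 : MvPolynomial (Fin 2) k) b * MvPolynomial.X 1 -
         Polynomial.aeval (MvPolynomial.X 0 : MvPolynomial (Fin 2) k) f} :
      Ideal (MvPolynomial (Fin 2) k)) with hmdef
  have hker : ∀ y : L, Polynomial.aeval α b * y = Polynomial.aeval α f →
      ∀ F, F ∈ m ↔ MvPolynomial.aeval ![α, y] F = 0 := by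
    intro y hy F
    have hle : m ≤ RingHom.ker (MvPolynomial.aeval ![α, y] : MvPolynomial (Fin 2) k →ₐ[k] L) := by
      rw [hmdef, Ideal.span_le]
      rintro G (rfl | rfl)
      · simp [RingHom.mem_ker, hα]
      · simp [RingHom.mem_ker, ← Polynomial.aeval_algHom_apply, hy]
    rw [hm.eq_of_le (RingHom.ker_ne_top _) hle, RingHom.mem_ker]
  have hb0 : Polynomial.aeval α b ≠ 0 := by
    intro hbα
    have hb' : b = 0 := eq_zero_of_aeval_cube_root_eq_zero ht hα hb hbα
    have hf' : f = 0 := by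
      let := Ideal.Quotient.field m
      refine eq_zero_of_aeval_cube_root_eq_zero ht (r := Ideal.Quotient.mk m (MvPolynomial.X 0))
        ?_ hf ?_
      · exact (Ideal.Quotient.mk_eq_mk_iff_sub_mem _ _).2
          (Ideal.subset_span (Set.mem_insert _ _))
      · rw [← Ideal.Quotient.mkₐ_eq_mk k, Polynomial.aeval_algHom_apply,
          Ideal.Quotient.mkₐ_eq_mk, Ideal.Quotient.eq_zero_iff_mem, ← neg_mem_iff]
        refine Ideal.subset_span (Set.mem_insert_of_mem _ ?_)
        simp [hb']
    have h1 := (hker 0 (by simp [hb', hf']) (MvPolynomial.X 1)).2 (by simp)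
    have h2 := (hker 1 (by simp [hb', hf']) (MvPolynomial.X 1)).1 h1
    simp at h2
  set y : L := Polynomial.aeval α f / Polynomial.aeval α b with hy
  have hmem := hker y (by rw [hy, mul_div_cancel₀ _ hb0])
  by_cases hline : ∃ F ∈ m, F ≠ 0 ∧ F.totalDegree ≤ 1
  · exact Or.inl hline
  refine Or.inr ⟨?_, fun F hF hF0 hFdeg => ?_⟩
  · have : FiniteDimensional k L := (AdjoinRoot.powerBasis hirr.ne_zero).finite
    have hfin : Module.finrank k L ≤ 3 := by
      rw [(AdjoinRoot.powerBasis hirr.ne_zero).finrank, AdjoinRoot.powerBasis_dim, hP]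
    obtain ⟨v, hv, hli⟩ := MvPolynomial.exists_three_conics hfin h2 ![α, y]
    exact ⟨v, fun i => ⟨(hmem _).2 (hv i).1, (hv i).2⟩, hli⟩
  have hind : ∀ a b c : k, algebraMap k L a * 1 + algebraMap k L b * α + algebraMap k L c * y = 0 →
      a = 0 ∧ b = 0 ∧ c = 0 := by
    intro a b c habc
    have hlin : (MvPolynomial.C a + MvPolynomial.C b * MvPolynomial.X 0 +
        MvPolynomial.C c * MvPolynomial.X 1 : MvPolynomial (Fin 2) k) = 0 := by
      by_contra hne
      refine hline ⟨_, (hmem _).2 ?_, hne, ?_⟩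
      · simpa using habc
      · refine (MvPolynomial.totalDegree_add _ _).trans (max_le
          ((MvPolynomial.totalDegree_add _ _).trans (max_le ?_ ?_)) ?_)
        · simp
        · exact (MvPolynomial.totalDegree_mul _ _).trans (by simp)
        · exact (MvPolynomial.totalDegree_mul _ _).trans (by simp)
    obtain ⟨ha, -, -, -, hc, hb⟩ := MvPolynomial.conic_coeffs_eq_zero h2 (a := a) (b := 0) (c := 0)
      (d := 0) (e := c) (g := b) (by simp only [map_zero]; linear_combination hlin)
    exact ⟨ha, hb, hc⟩
  obtain ⟨a, b', c, d, e, g, rfl⟩ := F.exists_eq_of_totalDegree_le_two hFdeg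
  have hFz := (hmem _).1 hF
  simp only [map_add, map_mul, map_pow, MvPolynomial.aeval_X, MvPolynomial.algHom_C,
    Matrix.cons_val_zero, Matrix.cons_val_one] at hFz
  simp only [map_add, map_mul, map_pow, MvPolynomial.map_X, MvPolynomial.map_C]
  have h2' : (2 : AlgebraicClosure k) ≠ 0 := by
    rw [← map_ofNat (algebraMap k (AlgebraicClosure k)) 2]
    exact (map_ne_zero _).2 h2
  refine MvPolynomial.irreducible_conic h2' fun hdet => hF0 ?_
  obtain ⟨rfl, rfl, rfl, rfl, rfl, rfl⟩ := ternary_form_eq_zero_of_det_eq_zero hcube hind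
    (A := a) (B := b') (C := c) (D := d) (E := e) (G := g)
    (FaithfulSMul.algebraMap_injective k (AlgebraicClosure k) (by
      simp only [map_add, map_sub, map_mul, map_pow, map_zero, map_ofNat]
      exact hdet))
    (by linear_combination hFz)
  simp
end

section
/- Let k be a field of characteristic 5 and t ∈ k with t ∉ k⁵. Let b, f ∈ k[X] be polynomials of degree at most 4 such that the ideal m of k[X,Y] generated by X⁵ − t and bY − f is maximal. Then either m contains a nonzero polynomial of total degree at most 1, or there exists F ∈ m of total degree 2 which is irreducible in k̄[X,Y], where k̄ is an algebraic closure of k. (Equivalently: either the degree-5 purely inseparable point lies on a line defined over k, or it lies on a geometrically integral conic.) -/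
/-- An element whose fifth power and square both lie in the subfield `k` lies in `k`. -/
theorem mem_range_algebraMap_of_sq {k K : Type*} [Field k] [Field K] [Algebra k K]
    (hK : ∀ x : K, x ^ 5 ∈ (algebraMap k K).range) {x : K} (hx : x ^ 2 ∈ (algebraMap k K).range) :
    ∃ s : k, algebraMap k K s = x := by
  obtain ⟨u, hu⟩ := hK x
  obtain ⟨v, hv⟩ := hx
  by_cases h0 : x = 0
  · exact ⟨0, by simp [h0]⟩
  · refine ⟨u / v ^ 2, ?_⟩
    rw [map_div₀, map_pow, hu, hv]
    field_simp

/-- A point all of whose coordinate functions have fifth powers in `k`, lying on a degenerate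
conic, lies on a line defined over `k`. -/
theorem exists_linear_relation_of_degenerate_conic {k K : Type*} [Field k] [Field K] [Algebra k K]
    (h2 : (2 : k) ≠ 0) (hK : ∀ x : K, x ^ 5 ∈ (algebraMap k K).range) (x y : K)
    {a b c d e f : k} (h0 : ¬ (a = 0 ∧ b = 0 ∧ c = 0))
    (hdet : 4 * a * c * f + b * d * e - a * e ^ 2 - c * d ^ 2 - f * b ^ 2 = 0)
    (hF : algebraMap k K a * x ^ 2 + algebraMap k K b * x * y + algebraMap k K c * y ^ 2 +
      algebraMap k K d * x + algebraMap k K e * y + algebraMap k K f = 0) :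
    ∃ u v w : k, ¬ (u = 0 ∧ v = 0 ∧ w = 0) ∧
      algebraMap k K u + algebraMap k K v * x + algebraMap k K w * y = 0 := by
  have hdet' := congrArg (algebraMap k K) hdet
  simp only [map_sub, map_add, map_mul, map_pow, map_zero, map_ofNat] at hdet'
  by_cases hc : c = 0
  · subst hc
    by_cases hb : b = 0
    · subst hb
      have ha : a ≠ 0 := by simpa using h0
      have he : e = 0 := by simpa [ha] using hdet
      subst he
      obtain ⟨s, hs⟩ := mem_range_algebraMap_of_sq hK
        (x := 2 * algebraMap k K a * x + algebraMap k K d) ⟨d ^ 2 - 4 * a * f, by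
          simp only [map_sub, map_mul, map_pow, map_ofNat, map_zero] at hF ⊢
          linear_combination -4 * algebraMap k K a * hF⟩
      refine ⟨d - s, 2 * a, 0, by simp [h2, ha], ?_⟩
      simp only [map_sub, map_mul, map_ofNat, map_zero]
      linear_combination -hs
    · have hprod : (algebraMap k K e + algebraMap k K b * x + algebraMap k K 0 * y) *
          (algebraMap k K (b * d - a * e) + algebraMap k K (a * b) * x +
            algebraMap k K (b ^ 2) * y) = 0 := by
        simp only [map_sub, map_mul, map_pow, map_zero] at hF hdet' ⊢
        linear_combination algebraMap k K b ^ 2 * hF + hdet'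
      rcases mul_eq_zero.mp hprod with h | h
      · exact ⟨_, _, _, by simp [hb], h⟩
      · exact ⟨_, _, _, by simp [hb], h⟩
  · have hsq : (2 * algebraMap k K c * y + algebraMap k K b * x + algebraMap k K e) ^ 2 =
        algebraMap k K (b ^ 2 - 4 * a * c) * x ^ 2 +
          algebraMap k K (2 * b * e - 4 * c * d) * x + algebraMap k K (e ^ 2 - 4 * c * f) := by
      simp only [map_sub, map_mul, map_pow, map_ofNat]
      linear_combination 4 * algebraMap k K c * hF
    have hdisc : (2 * b * e - 4 * c * d) ^ 2 =
        4 * (b ^ 2 - 4 * a * c) * (e ^ 2 - 4 * c * f) := by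
      linear_combination (-16 * c) * hdet
    generalize b ^ 2 - 4 * a * c = p at hsq hdisc
    generalize 2 * b * e - 4 * c * d = q at hsq hdisc
    generalize e ^ 2 - 4 * c * f = r at hsq hdisc
    by_cases hp : p = 0
    · subst hp
      have hq : q = 0 := by simpa using hdisc
      subst hq
      obtain ⟨s, hs⟩ := mem_range_algebraMap_of_sq hK
        (x := 2 * algebraMap k K c * y + algebraMap k K b * x + algebraMap k K e)
        ⟨r, by rw [hsq]; simp⟩
      refine ⟨e - s, b, 2 * c, by simp [h2, hc], ?_⟩
      simp only [map_sub, map_mul, map_ofNat]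
      linear_combination -hs
    · by_cases hl : 2 * algebraMap k K p * x + algebraMap k K q = 0
      · refine ⟨q, 2 * p, 0, by simp [h2, hp], ?_⟩
        simp only [map_mul, map_ofNat, map_zero]
        linear_combination hl
      · have hp' : algebraMap k K p ≠ 0 := by simpa using hp
        have h2' : (2 : K) ≠ 0 := by simpa only [map_ofNat] using (map_ne_zero (algebraMap k K)).mpr h2
        have hdisc' := congrArg (algebraMap k K) hdisc
        simp only [map_mul, map_pow, map_ofNat] at hdisc'
        obtain ⟨s, hs⟩ := mem_range_algebraMap_of_sq hK
          (x := (2 * algebraMap k K c * y + algebraMap k K b * x + algebraMap k K e) /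
            (2 * algebraMap k K p * x + algebraMap k K q))
          ⟨1 / (4 * p), by
            have h4 : (4 : K) ≠ 0 := by
              rw [show (4 : K) = 2 * 2 by norm_num]
              exact mul_ne_zero h2' h2'
            rw [div_pow, hsq, map_div₀, map_mul, map_ofNat, map_one,
              div_eq_div_iff (mul_ne_zero h4 hp') (pow_ne_zero 2 hl)]
            linear_combination hdisc'⟩
        rw [eq_div_iff hl] at hs
        refine ⟨e - s * q, b - s * (2 * p), 2 * c, by simp [h2, hc], ?_⟩
        simp only [map_sub, map_mul, map_ofNat]
        linear_combination -hs

open MvPolynomial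

/-- The affine form `u + v X + w Y`. -/
noncomputable def affineForm {k : Type*} [Field k] (u v w : k) : MvPolynomial (Fin 2) k :=
  C u + C v * X 0 + C w * X 1

/-- The quadratic polynomial `a X² + b XY + c Y² + d X + e Y + f`. -/
noncomputable def conicForm {k : Type*} [Field k] (a b c d e f : k) : MvPolynomial (Fin 2) k :=
  C a * X 0 ^ 2 + C b * (X 0 * X 1) + C c * X 1 ^ 2 + C d * X 0 + C e * X 1 + C f

theorem totalDegree_affineForm_le {k : Type*} [Field k] (u v w : k) :
    (affineForm u v w).totalDegree ≤ 1 := by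
  have hX (i : Fin 2) (v : k) : (C v * X i : MvPolynomial (Fin 2) k).totalDegree ≤ 1 :=
    (totalDegree_mul _ _).trans (by simp)
  exact (totalDegree_add _ _).trans
    (max_le ((totalDegree_add _ _).trans (max_le (by simp) (hX 0 v))) (hX 1 w))

theorem affineForm_ne_zero {k : Type*} [Field k] {u v w : k} (h : ¬ (u = 0 ∧ v = 0 ∧ w = 0)) :
    affineForm u v w ≠ 0 := by
  intro h0
  have h1 := congrArg (eval ![0, 0]) h0
  have h2 := congrArg (eval ![1, 0]) h0
  have h3 := congrArg (eval ![0, 1]) h0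
  simp [affineForm] at h1 h2 h3
  subst h1
  simp_all

theorem eq_affineForm_of_totalDegree_le_one {k : Type*} [Field k] {G : MvPolynomial (Fin 2) k}
    (hG : G.totalDegree ≤ 1) : ∃ u v w : k, G = affineForm u v w := by
  refine ⟨G.coeff 0, G.coeff (Finsupp.single 0 1), G.coeff (Finsupp.single 1 1), ?_⟩
  ext m
  by_cases hm : m.degree ≤ 1
  · rcases Nat.le_one_iff_eq_zero_or_eq_one.mp hm with h | h
    · rw [Finsupp.degree_eq_zero_iff] at h
      subst h
      simp [affineForm]
    · obtain ⟨i, rfl⟩ := (Finsupp.sum_eq_one_iff m).mp h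
      fin_cases i <;>
        simp [affineForm, coeff_C, coeff_X, coeff_C_mul, eq_comm (a := (0 : Fin 2 →₀ ℕ)),
          Finsupp.single_eq_single_iff]
  · rw [coeff_eq_zero_of_totalDegree_lt, coeff_eq_zero_of_totalDegree_lt]
    · exact (totalDegree_affineForm_le _ _ _).trans_lt (by simpa only [Finsupp.degree_apply, not_le] using hm)
    · exact hG.trans_lt (by simpa only [Finsupp.degree_apply, not_le] using hm)

theorem totalDegree_conicForm_le {k : Type*} [Field k] (a b c d e f : k) :
    (conicForm a b c d e f).totalDegree ≤ 2 := by
  have hC (v : k) {P : MvPolynomial (Fin 2) k} (hP : P.totalDegree ≤ 2) :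
      (C v * P).totalDegree ≤ 2 := (totalDegree_mul _ _).trans (by simpa using hP)
  have hadd {P Q : MvPolynomial (Fin 2) k} (hP : P.totalDegree ≤ 2) (hQ : Q.totalDegree ≤ 2) :
      (P + Q).totalDegree ≤ 2 := (totalDegree_add _ _).trans (max_le hP hQ)
  exact hadd (hadd (hadd (hadd (hadd (hC a (by simp))
    (hC b ((totalDegree_mul _ _).trans (by simp)))) (hC c (by simp))) (hC d (by simp)))
    (hC e (by simp))) (by simp)

theorem conicForm_ne_zero {k : Type*} [Field k] (h2 : (2 : k) ≠ 0) {a b c d e f : k}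
    (h : ¬ (a = 0 ∧ b = 0 ∧ c = 0 ∧ d = 0 ∧ e = 0 ∧ f = 0)) : conicForm a b c d e f ≠ 0 := by
  intro h0
  have h1 := congrArg (eval ![0, 0]) h0
  have h3 := congrArg (eval ![1, 0]) h0
  have h4 := congrArg (eval ![0, 1]) h0
  have h5 := congrArg (eval ![-1, 0]) h0
  have h6 := congrArg (eval ![0, -1]) h0
  have h7 := congrArg (eval ![1, 1]) h0
  simp [conicForm] at h1 h3 h4 h5 h6 h7
  subst h1
  have ha : a = 0 := (mul_eq_zero_iff_left h2).mp (by linear_combination h3 + h5)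
  have hc : c = 0 := (mul_eq_zero_iff_left h2).mp (by linear_combination h4 + h6)
  simp_all

/-- A product of two affine forms has vanishing discriminant. -/
theorem det_eq_zero_of_conicForm_eq_mul {k : Type*} [Field k] (h2 : (2 : k) ≠ 0)
    {a b c d e f u v w u' v' w' : k}
    (h : conicForm a b c d e f = affineForm u v w * affineForm u' v' w') :
    4 * a * c * f + b * d * e - a * e ^ 2 - c * d ^ 2 - f * b ^ 2 = 0 := by
  have h1 := congrArg (eval ![0, 0]) h
  have h3 := congrArg (eval ![1, 0]) h
  have h4 := congrArg (eval ![0, 1]) h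
  have h5 := congrArg (eval ![-1, 0]) h
  have h6 := congrArg (eval ![0, -1]) h
  have h7 := congrArg (eval ![1, 1]) h
  simp [conicForm, affineForm] at h1 h3 h4 h5 h6 h7
  have ha : a = v * v' := mul_left_cancel₀ h2 (by linear_combination h3 + h5 - 2 * h1)
  have hc : c = w * w' := mul_left_cancel₀ h2 (by linear_combination h4 + h6 - 2 * h1)
  have hd : d = u * v' + v * u' := by linear_combination h3 - h1 - ha
  have he : e = u * w' + w * u' := by linear_combination h4 - h1 - hc
  have hb : b = v * w' + w * v' := by linear_combination h7 - h1 - ha - hc - hd - he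
  subst h1 ha hc hd he hb
  ring

theorem one_le_totalDegree_of_not_isUnit {k : Type*} [Field k] {G : MvPolynomial (Fin 2) k}
    (h0 : G ≠ 0) (hG : ¬ IsUnit G) : 1 ≤ G.totalDegree := by
  by_contra! h
  rw [Nat.lt_one_iff, totalDegree_eq_zero_iff_eq_C] at h
  rw [h] at h0 hG
  exact hG ((isUnit_iff_ne_zero.mpr fun h => h0 (by rw [h, C_0])).map C)

/-- A plane conic with nonzero discriminant is irreducible. -/
theorem irreducible_conicForm {k : Type*} [Field k] (h2 : (2 : k) ≠ 0)
    {a b c d e f : k} (hdeg : (conicForm a b c d e f).totalDegree = 2)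
    (hdet : 4 * a * c * f + b * d * e - a * e ^ 2 - c * d ^ 2 - f * b ^ 2 ≠ 0) :
    Irreducible (conicForm a b c d e f) := by
  have hne : conicForm a b c d e f ≠ 0 := by
    intro h
    simp [h] at hdeg
  refine ⟨fun h => ?_, fun G H hGH => ?_⟩
  · have := (isUnit_iff_totalDegree_of_isReduced.mp h).2
    omega
  · by_contra! hu
    have hG0 : G ≠ 0 := left_ne_zero_of_mul (hGH ▸ hne)
    have hH0 : H ≠ 0 := right_ne_zero_of_mul (hGH ▸ hne)
    have hG := one_le_totalDegree_of_not_isUnit hG0 hu.1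
    have hH := one_le_totalDegree_of_not_isUnit hH0 hu.2
    rw [hGH, totalDegree_mul_of_isDomain hG0 hH0] at hdeg
    obtain ⟨u, v, w, rfl⟩ := eq_affineForm_of_totalDegree_le_one (G := G) (by omega)
    obtain ⟨u', v', w', rfl⟩ := eq_affineForm_of_totalDegree_le_one (G := H) (by omega)
    exact hdet (det_eq_zero_of_conicForm_eq_mul h2 hGH)

/-- A point with coordinates in a degree `5` extension of exponent one lies on a line over `k` or
on a geometrically integral conic over `k`. -/
theorem exists_line_or_integral_conic {k K : Type*} [Field k] [Field K] [Algebra k K]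
    (h2 : (2 : k) ≠ 0) (hK : ∀ x : K, x ^ 5 ∈ (algebraMap k K).range)
    (hfin : Module.finrank k K = 5) (x : Fin 2 → K) :
    (∃ F : MvPolynomial (Fin 2) k, aeval x F = 0 ∧ F ≠ 0 ∧ F.totalDegree ≤ 1) ∨
    (∃ F : MvPolynomial (Fin 2) k, aeval x F = 0 ∧ F.totalDegree = 2 ∧
      Irreducible (map (algebraMap k (AlgebraicClosure k)) F)) := by
  have : Module.Finite k K := Module.finite_of_finrank_pos (by omega)
  have hdep : ¬ LinearIndependent k ![x 0 ^ 2, x 0 * x 1, x 1 ^ 2, x 0, x 1, 1] := by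
    intro h
    have := h.fintype_card_le_finrank
    simp [hfin] at this
  obtain ⟨g, hg, i, hi⟩ := Fintype.not_linearIndependent_iff.mp hdep
  have hF : aeval x (conicForm (g 0) (g 1) (g 2) (g 3) (g 4) (g 5)) = 0 := by
    rw [← hg]
    simp [conicForm, Fin.sum_univ_succ, Algebra.smul_def]
    ring
  have hne : conicForm (g 0) (g 1) (g 2) (g 3) (g 4) (g 5) ≠ 0 := by
    refine conicForm_ne_zero h2 fun h => hi ?_
    fin_cases i <;> simp [h]
  generalize g 0 = a at *
  generalize g 1 = b at *
  generalize g 2 = c at *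
  generalize g 3 = d at *
  generalize g 4 = e at *
  generalize g 5 = f at *
  by_cases hdeg : (conicForm a b c d e f).totalDegree ≤ 1
  · exact Or.inl ⟨_, hF, hne, hdeg⟩
  have hdeg2 : (conicForm a b c d e f).totalDegree = 2 := by
    have := totalDegree_conicForm_le a b c d e f
    omega
  by_cases hdet : 4 * a * c * f + b * d * e - a * e ^ 2 - c * d ^ 2 - f * b ^ 2 = 0
  · left
    have h0 : ¬ (a = 0 ∧ b = 0 ∧ c = 0) := by
      rintro ⟨rfl, rfl, rfl⟩
      apply hdeg
      convert totalDegree_affineForm_le f d e using 2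
      simp [conicForm, affineForm]
      ring
    obtain ⟨u, v, w, huvw, h⟩ := exists_linear_relation_of_degenerate_conic h2 hK (x 0) (x 1) h0
      hdet (by simpa [conicForm, mul_assoc] using hF)
    exact ⟨affineForm u v w, by simpa [affineForm] using h, affineForm_ne_zero huvw,
      totalDegree_affineForm_le u v w⟩
  · right
    refine ⟨_, hF, hdeg2, ?_⟩
    have hinj := (algebraMap k (AlgebraicClosure k)).injective
    have hmap : map (algebraMap k (AlgebraicClosure k)) (conicForm a b c d e f) =
        conicForm (algebraMap k _ a) (algebraMap k _ b) (algebraMap k _ c) (algebraMap k _ d)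
          (algebraMap k _ e) (algebraMap k _ f) := by
      simp [conicForm]
    rw [hmap]
    refine irreducible_conicForm ?_ ?_ ?_
    · simpa only [map_ofNat] using (map_ne_zero (algebraMap k (AlgebraicClosure k))).mpr h2
    · rw [← hmap, totalDegree, support_map_of_injective _ hinj, ← totalDegree, hdeg2]
    · simpa only [map_sub, map_add, map_mul, map_pow, map_ofNat] using
        (map_ne_zero (algebraMap k (AlgebraicClosure k))).mpr hdet

theorem pow_five_mem_range_of_adjoinRoot {k : Type*} [Field k] [CharP k 5] (t : k)
    (z : AdjoinRoot (Polynomial.X ^ 5 - Polynomial.C t)) :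
    z ^ 5 ∈ (algebraMap k (AdjoinRoot (Polynomial.X ^ 5 - Polynomial.C t))).range := by
  have hp : Fact (Nat.Prime 5) := ⟨by norm_num⟩
  have hroot : (AdjoinRoot.root (Polynomial.X ^ 5 - Polynomial.C t)) ^ 5 =
      AdjoinRoot.of _ t := by
    have := AdjoinRoot.eval₂_root (Polynomial.X ^ 5 - Polynomial.C t)
    simpa [sub_eq_zero] using this
  have hnontriv : Nontrivial (AdjoinRoot (Polynomial.X ^ 5 - Polynomial.C t)) :=
    AdjoinRoot.nontrivial _ (by
      rw [Polynomial.degree_X_pow_sub_C (by norm_num)]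
      norm_num)
  have hchar : CharP (AdjoinRoot (Polynomial.X ^ 5 - Polynomial.C t)) 5 :=
    charP_of_injective_algebraMap (algebraMap k _).injective 5
  induction z using AdjoinRoot.induction_on with
  | ih p =>
    induction p using Polynomial.induction_on' with
    | add p q hp hq =>
      rw [map_add, add_pow_char]
      exact add_mem hp hq
    | monomial n a =>
      refine ⟨a ^ 5 * t ^ n, ?_⟩
      rw [← Polynomial.C_mul_X_pow_eq_monomial, map_mul, map_mul, map_pow, map_pow,
        map_pow, AdjoinRoot.mk_C, AdjoinRoot.mk_X, mul_pow, ← pow_mul, mul_comm n, pow_mul, hroot]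
      simp


/-- Let `k` be a field of characteristic `5` and `t ∈ k \ k⁵`.  If `b, f ∈ k[X]` have degree at
most `4` and the ideal `m = (X⁵ − t, b(X)Y − f(X))` of `k[X,Y]` is maximal, then either `m`
contains a nonzero polynomial of total degree at most `1` (the purely inseparable point of
degree `5` lies on a line defined over `k`), or `m` contains a polynomial of total degree `2`
which is irreducible over an algebraic closure `k̄` of `k` (the point lies on a geometrically
integral conic). -/
theorem degree_five_inseparable_point_line_or_integral_conic
    (k : Type*) [Field k] [CharP k 5]
    (t : k) (ht : ∀ a : k, a ^ 5 ≠ t) (b f : Polynomial k)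
    (hb : b.natDegree ≤ 4) (hf : f.natDegree ≤ 4)
    (hm : (Ideal.span
      {MvPolynomial.X 0 ^ 5 - MvPolynomial.C t,
       Polynomial.aeval (MvPolynomial.X 0 : MvPolynomial (Fin 2) k) b * MvPolynomial.X 1 -
         Polynomial.aeval (MvPolynomial.X 0 : MvPolynomial (Fin 2) k) f} :
      Ideal (MvPolynomial (Fin 2) k)).IsMaximal) :
    (∃ F ∈ (Ideal.span
      {MvPolynomial.X 0 ^ 5 - MvPolynomial.C t,
       Polynomial.aeval (MvPolynomial.X 0 : MvPolynomial (Fin 2) k) b * MvPolynomial.X 1 -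
         Polynomial.aeval (MvPolynomial.X 0 : MvPolynomial (Fin 2) k) f} :
      Ideal (MvPolynomial (Fin 2) k)), F ≠ 0 ∧ F.totalDegree ≤ 1) ∨
    (∃ F ∈ (Ideal.span
      {MvPolynomial.X 0 ^ 5 - MvPolynomial.C t,
       Polynomial.aeval (MvPolynomial.X 0 : MvPolynomial (Fin 2) k) b * MvPolynomial.X 1 -
         Polynomial.aeval (MvPolynomial.X 0 : MvPolynomial (Fin 2) k) f} :
      Ideal (MvPolynomial (Fin 2) k)), F.totalDegree = 2 ∧
      Irreducible (MvPolynomial.map (algebraMap k (AlgebraicClosure k)) F)) := by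
  have h2 : (2 : k) ≠ 0 := by
    intro h
    have h' : ((2 : ℕ) : k) = 0 := by exact_mod_cast h
    rw [CharP.cast_eq_zero_iff k 5] at h'
    omega
  set g : Polynomial k := Polynomial.X ^ 5 - Polynomial.C t with hg
  have hirr : Irreducible g := X_pow_sub_C_irreducible_of_prime (by norm_num) ht
  have hgdeg : g.natDegree = 5 := Polynomial.natDegree_X_pow_sub_C
  have : Fact (Irreducible g) := ⟨hirr⟩
  have hmk {q : Polynomial k} (hq : q.natDegree ≤ 4) (h0 : q ≠ 0) :
      AdjoinRoot.mk g q ≠ 0 := by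
    rw [Ne, AdjoinRoot.mk_eq_zero]
    intro h
    have := Polynomial.natDegree_le_of_dvd h h0
    omega
  have hroot : AdjoinRoot.root g ^ 5 = algebraMap k (AdjoinRoot g) t := by
    have := AdjoinRoot.eval₂_root g
    simpa [hg, sub_eq_zero] using this
  have hker (y : AdjoinRoot g) (hy : AdjoinRoot.mk g b * y = AdjoinRoot.mk g f)
      (F : MvPolynomial (Fin 2) k) :
      F ∈ (Ideal.span
        {MvPolynomial.X 0 ^ 5 - MvPolynomial.C t,
         Polynomial.aeval (MvPolynomial.X 0 : MvPolynomial (Fin 2) k) b * MvPolynomial.X 1 -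
           Polynomial.aeval (MvPolynomial.X 0 : MvPolynomial (Fin 2) k) f} :
        Ideal (MvPolynomial (Fin 2) k)) ↔ aeval ![AdjoinRoot.root g, y] F = 0 := by
    rw [hm.eq_of_le (RingHom.ker_ne_top (aeval (R := k) ![AdjoinRoot.root g, y])) ?_,
      RingHom.mem_ker]
    rw [Ideal.span_le, Set.insert_subset_iff, Set.singleton_subset_iff]
    constructor
    · simp [RingHom.mem_ker, hroot]
    · simp [RingHom.mem_ker, ← Polynomial.aeval_algHom_apply, AdjoinRoot.aeval_eq, hy]
  have hb0 : b ≠ 0 := by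
    rintro rfl
    by_cases hf0 : f = 0
    · subst hf0
      have h0 := (hker 0 (by simp) (X 1)).mpr (by simp)
      rw [hker 1 (by simp)] at h0
      simp at h0
    · have hcop : IsCoprime g f := (hirr.coprime_iff_not_dvd).mpr fun h => hmk hf hf0
        (AdjoinRoot.mk_eq_zero.mpr h)
      obtain ⟨u, v, huv⟩ := hcop
      apply hm.ne_top
      rw [Ideal.eq_top_iff_one]
      have h1 := congrArg (Polynomial.aeval (X 0 : MvPolynomial (Fin 2) k)) huv
      rw [map_add, map_mul, map_mul, map_one] at h1
      rw [← h1]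
      refine add_mem (Ideal.mul_mem_left _ _ (Ideal.subset_span ?_)) (Ideal.mul_mem_left _ _ ?_)
      · left
        simp [hg, algebraMap_eq]
      · rw [← neg_mem_iff]
        exact Ideal.subset_span (by simp)
  have hker' := hker (AdjoinRoot.mk g f / AdjoinRoot.mk g b) (mul_div_cancel₀ _ (hmk hb hb0))
  simp only [hker']
  refine exists_line_or_integral_conic h2 (pow_five_mem_range_of_adjoinRoot t) ?_ _
  rw [(AdjoinRoot.powerBasis hirr.ne_zero).finrank, AdjoinRoot.powerBasis_dim, hgdeg]
end

section
/- Let k be a field and let m ⊆ k[X,Y] be a maximal ideal such that dim_k k[X,Y]/m is odd and at least 3. Let F ∈ m be a polynomial of total degree 2. Then either F is irreducible in k̄[X,Y], where k̄ is an algebraic closure of k, or m contains a nonzero polynomial of total degree at most 1. (Equivalently: a conic passing through a point of odd degree at least 3 is geometrically integral, unless the point lies on a line defined over k.) -/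
open IntermediateField in
/-- A root of a monic quadratic polynomial generates an extension of degree `1` or `2`. -/
theorem coprime_finrank_adjoin_simple_of_quadratic {k E : Type*} [Field k] [Field E] [Algebra k E]
    {n : ℕ} (hn : Odd n) (a : E) (u v : k)
    (h : a ^ 2 + algebraMap k E u * a + algebraMap k E v = 0) :
    n.Coprime (Module.finrank k k⟮a⟯) := by
  have hmonic : (Polynomial.X ^ 2 + Polynomial.C u * Polynomial.X + Polynomial.C v).Monic := by
    monicity!
  have hroot : Polynomial.aeval a
      (Polynomial.X ^ 2 + Polynomial.C u * Polynomial.X + Polynomial.C v) = 0 := by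
    simpa using h
  have hint : IsIntegral k a := ⟨_, hmonic, hroot⟩
  rw [adjoin.finrank hint]
  have hpos := minpoly.natDegree_pos hint
  have hle : (minpoly k a).natDegree ≤ 2 := by
    refine (Polynomial.natDegree_le_natDegree (minpoly.min k a hmonic hroot)).trans ?_
    compute_degree
  generalize (minpoly k a).natDegree = d at *
  interval_cases d
  · simp
  · exact Nat.coprime_two_right.2 hn

open IntermediateField in
/-- An element of an odd degree extension satisfying a linear relation whose coefficients are
quadratic over `k` satisfies a linear relation over `k`. -/
theorem exists_linear_relation_of_quadratic {k E : Type*} [Field k] [Field E] [Algebra k E]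
    (A : IntermediateField k E) (hA : Odd (Module.finrank k A)) {x y : E} (hx : x ∈ A) (hy : y ∈ A)
    (a c : E) (u v s t : k)
    (ha : a ^ 2 + algebraMap k E u * a + algebraMap k E v = 0)
    (hc : c ^ 2 + algebraMap k E s * c + algebraMap k E t = 0)
    (h : a + x + c * y = 0) :
    ∃ p q r : k, (p ≠ 0 ∨ q ≠ 0 ∨ r ≠ 0) ∧
      algebraMap k E p + algebraMap k E q * x + algebraMap k E r * y = 0 := by
  have hcop : (Module.finrank k A).Coprime
      (Module.finrank k ((k⟮c⟯⟮a⟯).restrictScalars k)) := by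
    have h1 := coprime_finrank_adjoin_simple_of_quadratic hA c s t hc
    have h2 := coprime_finrank_adjoin_simple_of_quadratic (k := k⟮c⟯) hA a
      (algebraMap k _ u) (algebraMap k _ v) ha
    have h3 : Module.finrank k ((k⟮c⟯⟮a⟯).restrictScalars k) =
        Module.finrank k k⟮c⟯ * Module.finrank k⟮c⟯ k⟮c⟯⟮a⟯ :=
      (Module.finrank_mul_finrank k k⟮c⟯ k⟮c⟯⟮a⟯).symm
    rw [h3]
    exact h1.mul_right h2
  have hdis := LinearDisjoint.of_finrank_coprime hcop
  by_contra! hne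
  have hli : LinearIndependent k ![(1 : A), ⟨x, hx⟩, ⟨y, hy⟩] := by
    rw [Fintype.linearIndependent_iff]
    intro g hg
    have hg' : algebraMap k E (g 0) + algebraMap k E (g 1) * x + algebraMap k E (g 2) * y = 0 := by
      simpa [Fin.sum_univ_three, Algebra.smul_def] using congrArg (algebraMap A E) hg
    have hz : ¬ (g 0 ≠ 0 ∨ g 1 ≠ 0 ∨ g 2 ≠ 0) := fun h => hne _ _ _ h hg'
    push Not at hz
    intro i
    fin_cases i
    exacts [hz.1, hz.2.1, hz.2.2]
  have hli' := hdis.linearIndependent_left hli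
  have haN : a ∈ (k⟮c⟯⟮a⟯).restrictScalars k := mem_adjoin_simple_self k⟮c⟯ a
  have hcN : c ∈ (k⟮c⟯⟮a⟯).restrictScalars k :=
    (k⟮c⟯⟮a⟯).algebraMap_mem ⟨c, mem_adjoin_simple_self k c⟩
  rw [Fintype.linearIndependent_iff] at hli'
  have := hli' ![⟨a, haN⟩, 1, ⟨c, hcN⟩] (by
    simpa [Fin.sum_univ_three, Algebra.smul_def, IntermediateField.algebraMap_apply] using h) 1
  simp at this

/-- If a product of two linear forms has coefficients in `k` and one factor vanishes at a point of
odd degree, then the point lies on a line defined over `k`. -/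
theorem exists_linear_relation_of_product {k E : Type*} [Field k] [Field E] [Algebra k E]
    (A : IntermediateField k E) (hA : Odd (Module.finrank k A)) {x y : E} (hx : x ∈ A) (hy : y ∈ A)
    {a b c a' b' c' : E} {f₀₀ f₁₀ f₀₁ f₂₀ f₁₁ f₀₂ : k}
    (h₀₀ : algebraMap k E f₀₀ = a * a') (h₁₀ : algebraMap k E f₁₀ = a * b' + b * a')
    (h₀₁ : algebraMap k E f₀₁ = a * c' + c * a') (h₂₀ : algebraMap k E f₂₀ = b * b')
    (h₁₁ : algebraMap k E f₁₁ = b * c' + c * b') (h₀₂ : algebraMap k E f₀₂ = c * c')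
    (hbc : b ≠ 0 ∨ c ≠ 0) (hbc' : b' ≠ 0 ∨ c' ≠ 0) (h : a + b * x + c * y = 0) :
    ∃ p q r : k, (p ≠ 0 ∨ q ≠ 0 ∨ r ≠ 0) ∧
      algebraMap k E p + algebraMap k E q * x + algebraMap k E r * y = 0 := by
  by_cases hb : b * b' = 0
  · by_cases hc : c * c' = 0
    · rcases eq_or_ne b 0 with rfl | hb0
      · have hc0 : c ≠ 0 := by simpa using hbc
        obtain rfl : c' = 0 := by simpa [hc0] using hc
        have hb0 : b' ≠ 0 := by simpa using hbc'
        refine ⟨f₁₀, 0, f₁₁, .inr (.inr ?_), ?_⟩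
        · rw [← (algebraMap k E).injective.ne_iff, h₁₁]
          simp [hb0, hc0]
        · rw [h₁₀, h₁₁, map_zero]
          linear_combination b' * h
      · obtain rfl : b' = 0 := by simpa [hb0] using hb
        have hc0 : c' ≠ 0 := by simpa using hbc'
        obtain rfl : c = 0 := by simpa [hc0] using hc
        refine ⟨f₀₁, f₁₁, 0, .inr (.inl ?_), ?_⟩
        · rw [← (algebraMap k E).injective.ne_iff, h₁₁]
          simp [hb0, hc0]
        · rw [h₀₁, h₁₁, map_zero]
          linear_combination c' * h
    · obtain ⟨hc0, hc0'⟩ := mul_ne_zero_iff.1 hc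
      obtain ⟨p, q, r, h1, h2⟩ := exists_linear_relation_of_quadratic A hA hy hx (a / c) (b / c)
        (-(f₀₁ / f₀₂)) (f₀₀ / f₀₂) (-(f₁₁ / f₀₂)) (f₂₀ / f₀₂)
        (by simp only [map_neg, map_div₀, h₀₁, h₀₂, h₀₀]; field_simp; ring)
        (by simp only [map_neg, map_div₀, h₁₁, h₀₂, h₂₀]; field_simp; ring)
        (by field_simp; linear_combination h)
      exact ⟨p, r, q, by tauto, by linear_combination h2⟩
  · obtain ⟨hb0, hb0'⟩ := mul_ne_zero_iff.1 hb
    exact exists_linear_relation_of_quadratic A hA hx hy (a / b) (c / b)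
      (-(f₁₀ / f₂₀)) (f₀₀ / f₂₀) (-(f₁₁ / f₂₀)) (f₀₂ / f₂₀)
      (by simp only [map_neg, map_div₀, h₁₀, h₂₀, h₀₀]; field_simp; ring)
      (by simp only [map_neg, map_div₀, h₁₁, h₀₂, h₂₀]; field_simp; ring)
      (by field_simp; linear_combination h)

namespace MvPolynomial

open Finsupp in
/-- A bivariate polynomial of total degree at most `1` is affine linear. -/
theorem eq_monomial_add_of_totalDegree_le_one {R : Type*} [CommSemiring R]
    {G : MvPolynomial (Fin 2) R} (hG : G.totalDegree ≤ 1) :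
    G = monomial 0 (coeff 0 G) + monomial (single 0 1) (coeff (single 0 1) G)
      + monomial (single 1 1) (coeff (single 1 1) G) := by
  ext d
  have h01 : (single 0 1 : Fin 2 →₀ ℕ) ≠ single 1 1 := by
    simp [Finsupp.ext_iff, Fin.forall_fin_two]
  have h0 : (0 : Fin 2 →₀ ℕ) ≠ single 0 1 := by simp [Finsupp.ext_iff, Fin.forall_fin_two]
  have h1 : (0 : Fin 2 →₀ ℕ) ≠ single 1 1 := by simp [Finsupp.ext_iff, Fin.forall_fin_two]
  by_cases hd : d.degree ≤ 1
  · have : d = 0 ∨ d = single 0 1 ∨ d = single 1 1 := by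
      simp only [Finsupp.degree_eq_sum, Fin.sum_univ_two] at hd
      simp [Finsupp.ext_iff, Fin.forall_fin_two]
      omega
    rcases this with rfl | rfl | rfl <;>
      simp [coeff_monomial, h01, h0, h1, h01.symm, h0.symm, h1.symm]
  · rw [coeff_eq_zero_of_totalDegree_lt]
    · have e0 : (0 : Fin 2 →₀ ℕ) ≠ d := by rintro rfl; simp at hd
      have e1 : (single 0 1 : Fin 2 →₀ ℕ) ≠ d := by rintro rfl; simp at hd
      have e2 : (single 1 1 : Fin 2 →₀ ℕ) ≠ d := by rintro rfl; simp at hd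
      simp [coeff_monomial, e0, e1, e2]
    · have : d.degree = ∑ i ∈ d.support, d i := rfl
      omega

open Finsupp in
/-- The expansion of a product of two affine linear polynomials. -/
theorem mul_of_affine {R : Type*} [CommSemiring R] (a b c a' b' c' : R) :
    (monomial 0 a + monomial (single 0 1) b + monomial (single 1 1) c : MvPolynomial (Fin 2) R) *
      (monomial 0 a' + monomial (single 0 1) b' + monomial (single 1 1) c') =
    monomial 0 (a * a') + monomial (single 0 1) (a * b' + b * a')
      + monomial (single 1 1) (a * c' + c * a') + monomial (single 0 2) (b * b')
      + monomial (single 0 1 + single 1 1) (b * c' + c * b') + monomial (single 1 2) (c * c') := by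
  simp only [add_mul, mul_add, monomial_mul, map_add, add_zero, zero_add, ← single_add,
    add_comm (single (1 : Fin 2) 1) (single 0 1)]
  abel

/-- A nontrivial affine linear relation over `k` between coordinates gives a nonzero polynomial of total degree
at most `1` vanishing at the point. -/
theorem exists_totalDegree_le_one_of_aeval_eq_zero {k E : Type*} [Field k] [Field E] [Algebra k E]
    (P : Fin 2 → E) {p q r : k} (hpqr : p ≠ 0 ∨ q ≠ 0 ∨ r ≠ 0)
    (h : algebraMap k E p + algebraMap k E q * P 0 + algebraMap k E r * P 1 = 0) :
    ∃ G : MvPolynomial (Fin 2) k, aeval P G = 0 ∧ G ≠ 0 ∧ G.totalDegree ≤ 1 := by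
  refine ⟨C p + C q * X 0 + C r * X 1, ?_, ?_, ?_⟩
  · simpa [algebraMap_eq] using h
  · intro h0
    have hc (d : Fin 2 →₀ ℕ) := congrArg (coeff d) h0
    have hp : p = 0 := by simpa using hc 0
    have hq : q = 0 := by
      simpa [coeff_C, coeff_C_mul, coeff_X, Finsupp.ext_iff,
        Fin.forall_fin_two] using hc (Finsupp.single 0 1)
    have hr : r = 0 := by
      simpa [coeff_C, coeff_C_mul, coeff_X, Finsupp.ext_iff,
        Fin.forall_fin_two] using hc (Finsupp.single 1 1)
    simp [hp, hq, hr] at hpqr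
  · have hCX (s : k) (i : Fin 2) : (C s * X i : MvPolynomial (Fin 2) k).totalDegree ≤ 1 :=
      (totalDegree_mul _ _).trans (by simp)
    refine (totalDegree_add _ _).trans (max_le ?_ (hCX r 1))
    exact (totalDegree_add _ _).trans (max_le (by simp) (hCX q 0))

/-- A reducible polynomial of total degree `2` in two variables over a field is a product of two
affine linear polynomials. -/
theorem exists_affine_factors_of_not_irreducible {E : Type*} [Field E] {F : MvPolynomial (Fin 2) E}
    (hF : F.totalDegree = 2) (hirr : ¬ Irreducible F) :
    ∃ a b c a' b' c' : E, (b ≠ 0 ∨ c ≠ 0) ∧ (b' ≠ 0 ∨ c' ≠ 0) ∧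
      F = (monomial 0 a + monomial (Finsupp.single 0 1) b + monomial (Finsupp.single 1 1) c) *
        (monomial 0 a' + monomial (Finsupp.single 0 1) b' + monomial (Finsupp.single 1 1) c') := by
  have hF0 : F ≠ 0 := by
    rintro rfl
    simp at hF
  have hunit : ¬ IsUnit F := by
    intro hu
    have := (isUnit_iff_totalDegree_of_isReduced.1 hu).2
    omega
  obtain ⟨G₁, G₂, hG, hG₁, hG₂⟩ : ∃ G₁ G₂, F = G₁ * G₂ ∧ ¬ IsUnit G₁ ∧ ¬ IsUnit G₂ := by
    by_contra! hcon
    exact hirr ⟨hunit, fun G₁ G₂ h => or_iff_not_imp_left.2 (hcon G₁ G₂ h)⟩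
  have hne := mul_ne_zero_iff.1 (hG ▸ hF0)
  have hpos {G : MvPolynomial (Fin 2) E} (h0 : G ≠ 0) (hu : ¬ IsUnit G) : G.totalDegree ≠ 0 := by
    intro hd
    rw [totalDegree_eq_zero_iff_eq_C] at hd
    rw [hd] at h0 hu
    exact hu (IsUnit.map C (isUnit_iff_ne_zero.2 fun h => h0 (by rw [h, map_zero])))
  have hd := totalDegree_mul_of_isDomain hne.1 hne.2
  rw [← hG, hF] at hd
  have hd₁ := hpos hne.1 hG₁
  have hd₂ := hpos hne.2 hG₂
  have hlin {G : MvPolynomial (Fin 2) E} (h : G.totalDegree = 1) :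
      ∃ a b c, (b ≠ 0 ∨ c ≠ 0) ∧ G = monomial 0 a + monomial (Finsupp.single 0 1) b +
        monomial (Finsupp.single 1 1) c := by
    have hG := eq_monomial_add_of_totalDegree_le_one h.le
    refine ⟨_, _, _, ?_, hG⟩
    by_contra! hbc
    rw [hbc.1, hbc.2] at hG
    rw [hG] at h
    simp at h
  obtain ⟨a, b, c, hbc, rfl⟩ := hlin (show G₁.totalDegree = 1 by omega)
  obtain ⟨a', b', c', hbc', rfl⟩ := hlin (show G₂.totalDegree = 1 by omega)
  exact ⟨a, b, c, a', b', c', hbc, hbc', hG⟩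

/-- If a conic over `k` splits over an extension into two lines, one of which passes through a
point of odd degree over `k`, then this point lies on a line defined over `k`. -/
theorem exists_totalDegree_le_one_of_map_eq_mul {k E : Type*} [Field k] [Field E] [Algebra k E]
    (A : IntermediateField k E) (hA : Odd (Module.finrank k A)) {P : Fin 2 → E} (hP : ∀ i, P i ∈ A)
    {F : MvPolynomial (Fin 2) k} {a b c a' b' c' : E} (hbc : b ≠ 0 ∨ c ≠ 0)
    (hbc' : b' ≠ 0 ∨ c' ≠ 0) (hF : map (algebraMap k E) F =
      (monomial 0 a + monomial (Finsupp.single 0 1) b + monomial (Finsupp.single 1 1) c) *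
        (monomial 0 a' + monomial (Finsupp.single 0 1) b' + monomial (Finsupp.single 1 1) c'))
    (h : a + b * P 0 + c * P 1 = 0) :
    ∃ G : MvPolynomial (Fin 2) k, aeval P G = 0 ∧ G ≠ 0 ∧ G.totalDegree ≤ 1 := by
  have hcoeff (d : Fin 2 →₀ ℕ) := (coeff_map (algebraMap k E) F d).symm.trans
    (congrArg (coeff d) (hF.trans (mul_of_affine a b c a' b' c')))
  simp only [coeff_add, coeff_monomial, Finsupp.ext_iff, Fin.forall_fin_two] at hcoeff
  have h₁₁ := hcoeff (Finsupp.single 0 1 + Finsupp.single 1 1)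
  obtain ⟨p, q, r, hpqr, hrel⟩ := exists_linear_relation_of_product A hA (hP 0) (hP 1)
    (by simpa using hcoeff 0) (by simpa using hcoeff (Finsupp.single 0 1))
    (by simpa using hcoeff (Finsupp.single 1 1)) (by simpa using hcoeff (Finsupp.single 0 2))
    (by simpa using h₁₁)
    (by simpa using hcoeff (Finsupp.single 1 2)) hbc hbc' h
  exact exists_totalDegree_le_one_of_aeval_eq_zero P hpqr hrel

end MvPolynomial


/-- Let `k` be a field and `m ⊆ k[X,Y]` a maximal ideal whose residue field has odd degree at
least `3` over `k`.  Then any polynomial `F ∈ m` of total degree `2` is either irreducible over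
an algebraic closure `k̄` of `k`, or `m` contains a nonzero polynomial of total degree at most
`1`: a conic through a point of odd degree at least `3` is geometrically integral unless the
point lies on a line defined over `k`. -/
theorem conic_through_odd_degree_point_geometrically_integral_or_line
    (k : Type*) [Field k] (m : Ideal (MvPolynomial (Fin 2) k)) (hm : m.IsMaximal)
    (hodd : Odd (Module.finrank k (MvPolynomial (Fin 2) k ⧸ m)))
    (h3 : 3 ≤ Module.finrank k (MvPolynomial (Fin 2) k ⧸ m))
    (F : MvPolynomial (Fin 2) k) (hF : F ∈ m) (hFdeg : F.totalDegree = 2) :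
    Irreducible (MvPolynomial.map (algebraMap k (AlgebraicClosure k)) F) ∨
      ∃ G ∈ m, G ≠ 0 ∧ G.totalDegree ≤ 1 := by
  let _ : Field (MvPolynomial (Fin 2) k ⧸ m) := Ideal.Quotient.field m
  have : FiniteDimensional k (MvPolynomial (Fin 2) k ⧸ m) :=
    Module.finite_of_finrank_pos (by omega)
  rw [or_iff_not_imp_left]
  intro hirr
  have hdeg : (MvPolynomial.map (algebraMap k (AlgebraicClosure k)) F).totalDegree = 2 := by
    rw [MvPolynomial.totalDegree, MvPolynomial.support_map_of_injective _ (algebraMap k _).injective,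
      ← MvPolynomial.totalDegree, hFdeg]
  obtain ⟨a, b, c, a', b', c', hbc, hbc', hfac⟩ :=
    MvPolynomial.exists_affine_factors_of_not_irreducible hdeg hirr
  let σ : (MvPolynomial (Fin 2) k ⧸ m) →ₐ[k] AlgebraicClosure k := IsAlgClosed.lift
  let P : Fin 2 → AlgebraicClosure k := fun i => σ (Ideal.Quotient.mk m (MvPolynomial.X i))
  have hP (H : MvPolynomial (Fin 2) k) :
      MvPolynomial.aeval P H = σ (Ideal.Quotient.mk m H) := by
    have : MvPolynomial.aeval P = σ.comp (Ideal.Quotient.mkₐ k m) := by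
      ext i
      simp [P]
    rw [this]
    rfl
  have hroot : (a + b * P 0 + c * P 1) * (a' + b' * P 0 + c' * P 1) = 0 := by
    have : MvPolynomial.eval P (MvPolynomial.map (algebraMap k (AlgebraicClosure k)) F) = 0 := by
      rw [MvPolynomial.eval_map, ← MvPolynomial.aeval_def, hP,
        Ideal.Quotient.eq_zero_iff_mem.2 hF, map_zero]
    rw [hfac] at this
    simpa [MvPolynomial.eval_monomial] using this
  have hmem (i : Fin 2) : P i ∈ σ.fieldRange := ⟨_, rfl⟩
  have hA : Odd (Module.finrank k σ.fieldRange) := by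
    have h := (AlgEquiv.ofInjectiveField σ).toLinearEquiv.finrank_eq
    rw [h] at hodd
    exact hodd
  obtain ⟨G, hG, hG0, hGdeg⟩ :
      ∃ G : MvPolynomial (Fin 2) k, MvPolynomial.aeval P G = 0 ∧ G ≠ 0 ∧ G.totalDegree ≤ 1 := by
    rcases mul_eq_zero.1 hroot with h | h
    · exact MvPolynomial.exists_totalDegree_le_one_of_map_eq_mul _ hA hmem hbc hbc' hfac h
    · rw [mul_comm] at hfac
      exact MvPolynomial.exists_totalDegree_le_one_of_map_eq_mul _ hA hmem hbc' hbc hfac h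
  refine ⟨G, ?_, hG0, hGdeg⟩
  rw [← Ideal.Quotient.eq_zero_iff_mem]
  rw [hP] at hG
  exact (map_eq_zero σ).1 hG
end
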